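/- Let (e_k)_{k∈ℕ} denote the standard orthonormal basis of ℓ². Then sup over z ∈ ℓ² with ‖z‖ ≤ 6 of inf_{k∈ℕ} ‖z − 3e_k‖ equals √45. More precisely: (i) for every z ∈ ℓ² with ‖z‖ ≤ 6 one has inf_{k∈ℕ} ‖z − 3e_k‖ ≤ √45; and (ii) the point z = −6e₁ satisfies ‖z‖ = 6 and ‖z − 3e_k‖ ≥ √45 for every k ∈ ℕ. -/

import Mathlib

open MeasureTheory

/-- The Hilbert space ℓ² of square-summable real sequences. -/
noncomputable abbrev Hl2 : Type := lp (fun _ : ℕ => ℝ) 2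

/-- The standard orthonormal basis of ℓ². -/
noncomputable def stdBasis (k : ℕ) : Hl2 := lp.single 2 k (1 : ℝ)

theorem norm_stdBasis (k : ℕ) : ‖stdBasis k‖ = 1 := by
  simp [stdBasis, lp.norm_single]

theorem inner_stdBasis (z : Hl2) (k : ℕ) : inner ℝ z (stdBasis k) = z k := by
  rw [stdBasis, lp.inner_single_right]
  simp

theorem tendsto_apply_atTop_zero (z : Hl2) :
    Filter.Tendsto (fun k => z k) Filter.atTop (nhds 0) := by
  have h := (lp.hasSum_norm (p := 2) (by norm_num) z).summable.tendsto_atTop_zero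
  have h2 := h.sqrt
  rw [tendsto_zero_iff_norm_tendsto_zero]
  simpa [Real.sqrt_sq_eq_abs] using h2

theorem norm_sub_three_smul_stdBasis (z : Hl2) (k : ℕ) :
    ‖z - (3:ℝ) • stdBasis k‖ = Real.sqrt (‖z‖ ^ 2 + 9 - 6 * z k) := by
  rw [← Real.sqrt_sq (norm_nonneg (z - (3:ℝ) • stdBasis k)), norm_sub_sq_real,
    inner_smul_right, inner_stdBasis, norm_smul, norm_stdBasis]
  congr 1
  norm_num
  ring

theorem tendsto_norm_sub_three_smul_stdBasis (z : Hl2) :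
    Filter.Tendsto (fun k => ‖z - (3:ℝ) • stdBasis k‖) Filter.atTop
      (nhds (Real.sqrt (‖z‖ ^ 2 + 9))) := by
  simp only [norm_sub_three_smul_stdBasis]
  simpa using (((tendsto_apply_atTop_zero z).const_mul 6).const_sub (‖z‖ ^ 2 + 9)).sqrt

theorem iInf_norm_sub_three_smul_stdBasis_le {z : Hl2} (hz : ‖z‖ ≤ 6) :
    (⨅ k : ℕ, ‖z - (3:ℝ) • stdBasis k‖) ≤ Real.sqrt 45 := by
  have h : (⨅ k : ℕ, ‖z - (3:ℝ) • stdBasis k‖) ≤ Real.sqrt (‖z‖ ^ 2 + 9) :=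
    ge_of_tendsto' (tendsto_norm_sub_three_smul_stdBasis z) fun k =>
      ciInf_le ⟨0, by rintro _ ⟨j, rfl⟩; exact norm_nonneg _⟩ k
  refine h.trans (Real.sqrt_le_sqrt ?_)
  nlinarith [norm_nonneg z]

theorem norm_neg_six_smul_stdBasis (j : ℕ) : ‖(-6:ℝ) • stdBasis j‖ = 6 := by
  rw [norm_smul, norm_stdBasis]
  norm_num

theorem sqrt_le_norm_neg_six_smul_sub (j k : ℕ) :
    Real.sqrt 45 ≤ ‖(-6:ℝ) • stdBasis j - (3:ℝ) • stdBasis k‖ := by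
  rw [norm_sub_three_smul_stdBasis, norm_neg_six_smul_stdBasis]
  apply Real.sqrt_le_sqrt
  have h : 0 ≤ stdBasis j k := by
    by_cases hjk : k = j
    · subst hjk
      simp [stdBasis]
    · simp [stdBasis, hjk]
  have h' : ((-6:ℝ) • stdBasis j : Hl2) k = -6 * stdBasis j k := rfl
  rw [h']
  linarith

/-- Example of the paper (pursuers with integral constraints): with pursuers at `3e_k` the
farthest-point value over the ball `B(0,6)` is `√45`; every point of the ball is within
`√45` of some `3e_k`, while `z = -6e₁` realizes the value. -/
theorem example_integral_constraint_value :
    (⨆ z : {z : Hl2 // ‖z‖ ≤ 6}, ⨅ k : ℕ, ‖(z : Hl2) - (3:ℝ) • stdBasis k‖)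
        = Real.sqrt 45 ∧
    (∀ z : Hl2, ‖z‖ ≤ 6 → (⨅ k : ℕ, ‖z - (3:ℝ) • stdBasis k‖) ≤ Real.sqrt 45) ∧
    (‖(-6:ℝ) • stdBasis 0‖ = 6 ∧
      ∀ k : ℕ, Real.sqrt 45 ≤ ‖(-6:ℝ) • stdBasis 0 - (3:ℝ) • stdBasis k‖) := by
  refine ⟨le_antisymm ?_ ?_, fun z hz => iInf_norm_sub_three_smul_stdBasis_le hz,
    norm_neg_six_smul_stdBasis 0, sqrt_le_norm_neg_six_smul_sub 0⟩
  · have : Nonempty {z : Hl2 // ‖z‖ ≤ 6} := ⟨⟨0, by simp⟩⟩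
    exact ciSup_le fun z => iInf_norm_sub_three_smul_stdBasis_le z.2
  · refine le_ciSup_of_le ⟨Real.sqrt 45, ?_⟩
      ⟨(-6:ℝ) • stdBasis 0, (norm_neg_six_smul_stdBasis 0).le⟩
      (le_ciInf (sqrt_le_norm_neg_six_smul_sub 0))
    rintro _ ⟨z, rfl⟩
    exact iInf_norm_sub_three_smul_stdBasis_le z.2
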